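/- Fix τ ∈ (0,π), γ ∈ 𝕋 and a finite positive Borel measure σ on 𝕋. Let {μ_{nk}} be an infinitesimal array of probability measures on 𝕋, each with nonzero first moment, and let {λ_n}_{n≥1} ⊂ 𝕋. If λ_n · Π_{k=1}^{k_n} B_{μ_{nk}}(z) converges to γ·exp(−∫_𝕋 (1+ζz)/(1−ζz) dσ(ζ)) uniformly on compact subsets of 𝔻 as n → ∞ (i.e., the boolean convolutions δ_{λ_n} ⨃ μ_{n1} ⨃ ⋯ ⨃ μ_{nk_n} converge weakly to ν_⨃^{γ,σ}), then the measures σ_n converge weakly on 𝕋 to σ and γ_n → γ as n → ∞. -/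

import Mathlib

open MeasureTheory Complex Filter Topology Metric

noncomputable section

instance : MeasurableSpace Circle := borel Circle
instance : BorelSpace Circle := ⟨rfl⟩

/-- ψ_μ(z) = ∫ ζz/(1-ζz) dμ(ζ). -/
def psiT (μ : Measure Circle) (z : ℂ) : ℂ :=
  ∫ ζ : Circle, ((ζ : ℂ) * z) / (1 - (ζ : ℂ) * z) ∂μ

/-- The B-transform of a measure on the circle:
B_μ(z) = (1/z)·ψ_μ(z)/(1+ψ_μ(z)) for z ≠ 0 and B_μ(0) = ∫ ζ dμ. -/
def BT (μ : Measure Circle) (z : ℂ) : ℂ :=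
  if z = 0 then ∫ ζ : Circle, (ζ : ℂ) ∂μ
  else z⁻¹ * (psiT μ z / (1 + psiT μ z))

/-- Infinitesimal triangular array: max_{1≤k≤k_n} μ_{nk}{|ζ-1| ≥ ε} → 0 as n → ∞. -/
def IsInfinitesimalArrayT (kn : ℕ → ℕ) (μ : ℕ → ℕ → Measure Circle) : Prop :=
  ∀ ε : ℝ, 0 < ε → ∀ δ : ENNReal, 0 < δ → ∃ N : ℕ, ∀ n ≥ N, ∀ i < kn n,
    μ n i {ζ : Circle | ε ≤ ‖(ζ : ℂ) - 1‖} < δ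

/-- β = ∫_{|arg ζ|<τ} arg ζ dμ. -/
def betaT (τ : ℝ) (μ : Measure Circle) : ℝ :=
  ∫ ζ in {ζ : Circle | |Complex.arg (ζ : ℂ)| < τ}, Complex.arg (ζ : ℂ) ∂μ

/-- b = e^{iβ} as an element of the circle. -/
def bT (τ : ℝ) (μ : Measure Circle) : Circle := Circle.exp (betaT τ μ)

/-- μ° : the centering of μ, i.e. the pushforward of μ under ζ ↦ b⁻¹ ζ. -/
def centerT (τ : ℝ) (μ : Measure Circle) : Measure Circle :=
  Measure.map (fun ζ => (bT τ μ)⁻¹ * ζ) μ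

/-- h(z) = -i ∫ Im ζ dμ° + ∫ (1+ζz)/(1-ζz)·(1-Re ζ) dμ°, for the centered measure μ°. -/
def hT (τ : ℝ) (μ : Measure Circle) (z : ℂ) : ℂ :=
  -Complex.I * ((∫ ζ : Circle, ((ζ : ℂ)).im ∂(centerT τ μ) : ℝ) : ℂ) +
    ∫ ζ : Circle, ((1 + (ζ : ℂ) * z) / (1 - (ζ : ℂ) * z)) * ((1 - ((ζ : ℂ)).re : ℝ) : ℂ)
      ∂(centerT τ μ)

/-- The measure dσ_n(ζ) = Σ_{k=1}^{k_n} (1 − Re ζ) dμ_{nk}°(ζ). -/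
def sigmaNT (τ : ℝ) (kn : ℕ → ℕ) (μ : ℕ → ℕ → Measure Circle) (n : ℕ) : Measure Circle :=
  ∑ i ∈ Finset.range (kn n),
    (centerT τ (μ n i)).withDensity (fun ζ => ENNReal.ofReal (1 - ((ζ : ℂ)).re))

/-- γ_n = exp(i arg λ_n + i Σ_k β_{nk} + i Σ_k ∫ Im ζ dμ_{nk}°). -/
def gammaNT (τ : ℝ) (kn : ℕ → ℕ) (μ : ℕ → ℕ → Measure Circle) (lam : ℕ → Circle) (n : ℕ) : ℂ :=
  Complex.exp (Complex.I * ((Complex.arg (lam n : ℂ)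
    + ∑ i ∈ Finset.range (kn n), betaT τ (μ n i)
    + ∑ i ∈ Finset.range (kn n), ∫ ζ : Circle, ((ζ : ℂ)).im ∂(centerT τ (μ n i)) : ℝ) : ℂ))

/-- The B-transform of the ⨃-infinitely divisible measure ν_⨃^{γ,σ}:
B(z) = γ·exp(−∫ (1+ζz)/(1−ζz) dσ(ζ)). -/
def BID (γ : Circle) (σ : Measure Circle) (z : ℂ) : ℂ :=
  (γ : ℂ) * Complex.exp (-∫ ζ : Circle, (1 + (ζ : ℂ) * z) / (1 - (ζ : ℂ) * z) ∂σ)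

theorem Continuous.integrable_circle {E : Type*} [NormedAddCommGroup E] {f : Circle → E}
    (hf : Continuous f) (ν : Measure Circle) [IsFiniteMeasure ν] : Integrable f ν :=
  hf.integrable_of_hasCompactSupport (HasCompactSupport.of_compactSpace f)

theorem norm_coe_circle_mul (ζ : Circle) (z : ℂ) : ‖(ζ : ℂ) * z‖ = ‖z‖ := by
  simp [Circle.norm_coe]

theorem one_sub_norm_le (ζ : Circle) (z : ℂ) : 1 - ‖z‖ ≤ ‖1 - (ζ : ℂ) * z‖ := by
  have := norm_sub_norm_le (1 : ℂ) ((ζ : ℂ) * z)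
  simpa [Circle.norm_coe] using this

theorem one_sub_circle_mul_ne_zero (ζ : Circle) {z : ℂ} (hz : ‖z‖ < 1) :
    1 - (ζ : ℂ) * z ≠ 0 := by
  have := one_sub_norm_le ζ z
  rw [← norm_pos_iff]
  linarith

/-- Convergence of integrals is preserved under uniform approximation of the integrand. -/
theorem tendsto_integral_of_uniform_approx {E : Type*} [NormedAddCommGroup E] [NormedSpace ℝ E]
    {σn : ℕ → Measure Circle} {σ : Measure Circle} [∀ n, IsFiniteMeasure (σn n)]
    [IsFiniteMeasure σ] {C : ℝ} (hC : ∀ᶠ n in atTop, (σn n).real Set.univ ≤ C)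
    {f : Circle → E} (hf : Continuous f)
    (h : ∀ ε > 0, ∃ g : Circle → E, Continuous g ∧ (∀ ζ, ‖f ζ - g ζ‖ ≤ ε) ∧
      Tendsto (fun n => ∫ ζ, g ζ ∂(σn n)) atTop (𝓝 (∫ ζ, g ζ ∂σ))) :
    Tendsto (fun n => ∫ ζ, f ζ ∂(σn n)) atTop (𝓝 (∫ ζ, f ζ ∂σ)) := by
  have key : ∀ (ν : Measure Circle) [IsFiniteMeasure ν] (g : Circle → E), Continuous g →
      ∀ ε, (∀ ζ, ‖f ζ - g ζ‖ ≤ ε) →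
      ‖∫ ζ, f ζ ∂ν - ∫ ζ, g ζ ∂ν‖ ≤ ε * ν.real Set.univ := by
    intro ν _ g hg ε hε
    rw [← integral_sub (hf.integrable_circle ν) (hg.integrable_circle ν)]
    exact norm_integral_le_of_norm_le_const (.of_forall hε)
  have hσ0 : 0 ≤ σ.real Set.univ := measureReal_nonneg
  have hC0 : 0 ≤ |C| := abs_nonneg C
  rw [Metric.tendsto_nhds]
  intro ε hε
  set D := |C| + σ.real Set.univ + 1 with hD
  have hD0 : 0 < D := by positivity
  obtain ⟨g, hg, hfg, hgt⟩ := h (ε / (2 * D)) (by positivity)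
  rw [Metric.tendsto_nhds] at hgt
  filter_upwards [hC, hgt (ε / 2) (by positivity)] with n hn hgn
  have h1 := key (σn n) g hg _ hfg
  have h2 := key σ g hg _ hfg
  rw [dist_eq_norm] at hgn ⊢
  have h3 : ‖∫ ζ, f ζ ∂(σn n) - ∫ ζ, f ζ ∂σ‖ ≤
      ‖∫ ζ, f ζ ∂(σn n) - ∫ ζ, g ζ ∂(σn n)‖ + ‖∫ ζ, g ζ ∂(σn n) - ∫ ζ, g ζ ∂σ‖
        + ‖∫ ζ, f ζ ∂σ - ∫ ζ, g ζ ∂σ‖ := by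
    have : ∫ ζ, f ζ ∂(σn n) - ∫ ζ, f ζ ∂σ =
      (∫ ζ, f ζ ∂(σn n) - ∫ ζ, g ζ ∂(σn n)) + (∫ ζ, g ζ ∂(σn n) - ∫ ζ, g ζ ∂σ)
        - (∫ ζ, f ζ ∂σ - ∫ ζ, g ζ ∂σ) := by abel
    rw [this]
    exact (norm_sub_le _ _).trans (add_le_add_left (norm_add_le _ _) _)
  have h4 : ε / (2 * D) * (σn n).real Set.univ + ε / (2 * D) * σ.real Set.univ ≤ ε / 2 := by
    have : ε / 2 = ε / (2 * D) * D := by field_simp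
    rw [this, ← mul_add]
    gcongr
    linarith [le_abs_self C]
  linarith

theorem continuous_pow_div_one_sub (u : Circle) {r : ℝ} (hr : 0 ≤ r) (hr1 : r < 1) (m : ℕ) :
    Continuous fun ζ : Circle => (((u * ζ : Circle) : ℂ) ^ m / (1 - ((u * ζ : Circle) : ℂ) * r)) := by
  refine Continuous.div (by fun_prop) (by fun_prop) fun ζ => ?_
  exact one_sub_circle_mul_ne_zero _ (by simpa [abs_of_nonneg hr])

theorem tendsto_integral_re_pow_div {σn : ℕ → Measure Circle} {σ : Measure Circle}
    [∀ n, IsFiniteMeasure (σn n)] [IsFiniteMeasure σ] {C : ℝ}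
    (hC : ∀ᶠ n in atTop, (σn n).real Set.univ ≤ C)
    (h0 : Tendsto (fun n => (σn n).real Set.univ) atTop (𝓝 (σ.real Set.univ)))
    (h : ∀ z : ℂ, ‖z‖ < 1 →
      Tendsto (fun n => ∫ ζ : Circle, ((1 + (ζ : ℂ) * z) / (1 - (ζ : ℂ) * z)).re ∂(σn n)) atTop
        (𝓝 (∫ ζ : Circle, ((1 + (ζ : ℂ) * z) / (1 - (ζ : ℂ) * z)).re ∂σ))) (m : ℕ) (u : Circle) :
    (∀ r : ℝ, 0 < r → r < 1 →
      Tendsto (fun n => ∫ ζ : Circle,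
          ((((u * ζ : Circle) : ℂ) ^ m / (1 - ((u * ζ : Circle) : ℂ) * r))).re ∂(σn n)) atTop
        (𝓝 (∫ ζ : Circle,
          ((((u * ζ : Circle) : ℂ) ^ m / (1 - ((u * ζ : Circle) : ℂ) * r))).re ∂σ))) ∧
      Tendsto (fun n => ∫ ζ : Circle, (((u * ζ : Circle) : ℂ) ^ m).re ∂(σn n)) atTop
        (𝓝 (∫ ζ : Circle, (((u * ζ : Circle) : ℂ) ^ m).re ∂σ)) := by
  have limit : ∀ m : ℕ, (∀ r : ℝ, 0 < r → r < 1 →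
      Tendsto (fun n => ∫ ζ : Circle,
          ((((u * ζ : Circle) : ℂ) ^ m / (1 - ((u * ζ : Circle) : ℂ) * r))).re ∂(σn n)) atTop
        (𝓝 (∫ ζ : Circle,
          ((((u * ζ : Circle) : ℂ) ^ m / (1 - ((u * ζ : Circle) : ℂ) * r))).re ∂σ))) →
      Tendsto (fun n => ∫ ζ : Circle, (((u * ζ : Circle) : ℂ) ^ m).re ∂(σn n)) atTop
        (𝓝 (∫ ζ : Circle, (((u * ζ : Circle) : ℂ) ^ m).re ∂σ)) := by
    intro m hm
    refine tendsto_integral_of_uniform_approx hC (by fun_prop) fun ε hε => ?_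
    set r : ℝ := min (1 / 2) (ε / 2) with hr
    have hr0 : 0 < r := by positivity
    have hr1 : r ≤ 1 / 2 := min_le_left _ _
    have hr2 : r ≤ ε / 2 := min_le_right _ _
    refine ⟨_, continuous_re.comp (continuous_pow_div_one_sub u hr0.le (by linarith) m),
      fun ζ => ?_, hm r hr0 (by linarith)⟩
    simp only [Function.comp_apply]
    rw [← sub_re, Real.norm_eq_abs]
    refine (abs_re_le_norm _).trans ?_
    generalize u * ζ = x
    have hx : 1 - (x : ℂ) * r ≠ 0 :=
      one_sub_circle_mul_ne_zero _ (by simp [abs_of_pos hr0]; linarith)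
    have hx' : 1 / 2 ≤ ‖1 - (x : ℂ) * r‖ := by
      have := one_sub_norm_le x (r : ℂ)
      simp only [norm_real, Real.norm_eq_abs, abs_of_pos hr0] at this
      linarith
    have : (x : ℂ) ^ m - (x : ℂ) ^ m / (1 - (x : ℂ) * r) =
        - ((x : ℂ) ^ (m + 1) * r) / (1 - (x : ℂ) * r) := by
      field_simp
      ring
    rw [this, norm_div, norm_neg, norm_mul, norm_pow, Circle.norm_coe, one_pow, one_mul,
      norm_real, Real.norm_eq_abs, abs_of_pos hr0, div_le_iff₀ (by linarith)]
    nlinarith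
  suffices H : ∀ r : ℝ, 0 < r → r < 1 →
      Tendsto (fun n => ∫ ζ : Circle,
          ((((u * ζ : Circle) : ℂ) ^ m / (1 - ((u * ζ : Circle) : ℂ) * r))).re ∂(σn n)) atTop
        (𝓝 (∫ ζ : Circle,
          ((((u * ζ : Circle) : ℂ) ^ m / (1 - ((u * ζ : Circle) : ℂ) * r))).re ∂σ)) from
    ⟨H, limit m H⟩
  induction m with
  | zero =>
    intro r hr hr1
    have hz : ‖(u : ℂ) * r‖ < 1 := by simpa [abs_of_pos hr, Circle.norm_coe]
    have e : ∀ (ν : Measure Circle) [IsFiniteMeasure ν], ∫ ζ : Circle,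
        ((((u * ζ : Circle) : ℂ) ^ 0 / (1 - ((u * ζ : Circle) : ℂ) * r))).re ∂ν =
        (1 / 2) * (ν.real Set.univ + ∫ ζ : Circle,
          ((1 + (ζ : ℂ) * (u * r)) / (1 - (ζ : ℂ) * (u * r))).re ∂ν) := by
      intro ν _
      have hc : Continuous fun ζ : Circle =>
          ((1 + (ζ : ℂ) * (u * r)) / (1 - (ζ : ℂ) * (u * r))).re :=
        continuous_re.comp (Continuous.div (by fun_prop) (by fun_prop)
          fun ζ => one_sub_circle_mul_ne_zero ζ hz)
      have h1 : ν.real Set.univ = ∫ _ : Circle, (1 : ℝ) ∂ν := by simp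
      rw [h1, ← integral_add (integrable_const _) (hc.integrable_circle ν), ← integral_const_mul]
      refine integral_congr_ae (.of_forall fun ζ => ?_)
      have hx := one_sub_circle_mul_ne_zero ζ hz
      have : (((u * ζ : Circle) : ℂ) ^ 0 / (1 - ((u * ζ : Circle) : ℂ) * r)) =
          ((1 / 2 : ℝ) : ℂ) * (1 + (1 + (ζ : ℂ) * (u * r)) / (1 - (ζ : ℂ) * (u * r))) := by
        rw [Circle.coe_mul, show (u : ℂ) * ζ * r = ζ * (u * r) by ring]
        generalize (ζ : ℂ) * (u * r) = w at hx
        push_cast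
        field_simp
        ring
      simp only [this, re_ofReal_mul, add_re, one_re]
    simp only [e]
    exact (h0.add (h _ hz)).const_mul _
  | succ m ih =>
    intro r hr hr1
    have e : ∀ (ν : Measure Circle) [IsFiniteMeasure ν], ∫ ζ : Circle,
        ((((u * ζ : Circle) : ℂ) ^ (m + 1) / (1 - ((u * ζ : Circle) : ℂ) * r))).re ∂ν =
        r⁻¹ * (∫ ζ : Circle, ((((u * ζ : Circle) : ℂ) ^ m / (1 - ((u * ζ : Circle) : ℂ) * r))).re ∂ν
          - ∫ ζ : Circle, (((u * ζ : Circle) : ℂ) ^ m).re ∂ν) := by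
      intro ν _
      have hc : Continuous fun ζ : Circle =>
          ((((u * ζ : Circle) : ℂ) ^ m / (1 - ((u * ζ : Circle) : ℂ) * r))).re :=
        continuous_re.comp (continuous_pow_div_one_sub u hr.le hr1 m)
      have hc' : Continuous fun ζ : Circle => (((u * ζ : Circle) : ℂ) ^ m).re := by fun_prop
      rw [← integral_sub (hc.integrable_circle ν) (hc'.integrable_circle ν), ← integral_const_mul]
      refine integral_congr_ae (.of_forall fun ζ => ?_)
      simp only []
      generalize u * ζ = x
      have hx : 1 - (x : ℂ) * r ≠ 0 := one_sub_circle_mul_ne_zero _ (by simpa [abs_of_pos hr])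
      have hr' : (r : ℂ) ≠ 0 := by exact_mod_cast hr.ne'
      rw [← sub_re, ← re_ofReal_mul]
      congr 1
      push_cast
      field_simp
      ring
    simp only [e]
    exact ((ih r hr hr1).sub (limit m ih)).const_mul _

theorem tendsto_integral_pow {σn : ℕ → Measure Circle} {σ : Measure Circle}
    [∀ n, IsFiniteMeasure (σn n)] [IsFiniteMeasure σ]
    (h : ∀ (m : ℕ) (u : Circle),
      Tendsto (fun n => ∫ ζ : Circle, (((u * ζ : Circle) : ℂ) ^ m).re ∂(σn n)) atTop
        (𝓝 (∫ ζ : Circle, (((u * ζ : Circle) : ℂ) ^ m).re ∂σ))) (m : ℕ) :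
    Tendsto (fun n => ∫ ζ : Circle, (ζ : ℂ) ^ m ∂(σn n)) atTop
      (𝓝 (∫ ζ : Circle, (ζ : ℂ) ^ m ∂σ)) := by
  have e : ∀ (ν : Measure Circle) [IsFiniteMeasure ν], ∫ ζ : Circle, (ζ : ℂ) ^ m ∂ν =
      ((∫ ζ : Circle, ((ζ : ℂ) ^ m).re ∂ν : ℝ) : ℂ)
        + ((∫ ζ : Circle, ((ζ : ℂ) ^ m).im ∂ν : ℝ) : ℂ) * I := by
    intro ν _
    have hi : Integrable (fun ζ : Circle => (ζ : ℂ) ^ m) ν :=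
      Continuous.integrable_circle (by fun_prop) ν
    exact (integral_re_add_im hi).symm
  have him : Tendsto (fun n => ∫ ζ : Circle, ((ζ : ℂ) ^ m).im ∂(σn n)) atTop
      (𝓝 (∫ ζ : Circle, ((ζ : ℂ) ^ m).im ∂σ)) := by
    rcases Nat.eq_zero_or_pos m with rfl | hm
    · simp
    · have hu : ((Circle.exp (-(Real.pi / 2) / m) : Circle) : ℂ) ^ m = -I := by
        rw [Circle.coe_exp, ← Complex.exp_nat_mul]
        have : (m : ℂ) ≠ 0 := by exact_mod_cast hm.ne'
        have : (m : ℂ) * (((-(Real.pi / 2) / m : ℝ) : ℂ) * I) = -(Real.pi / 2 * I) := by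
          push_cast
          field_simp
        rw [this, Complex.exp_neg, Complex.exp_pi_div_two_mul_I]
        simp
      have := h m (Circle.exp (-(Real.pi / 2) / m))
      simp only [Circle.coe_mul, mul_pow, hu] at this
      simpa using this
  simp only [e]
  have hre := h m 1
  simp only [one_mul] at hre
  exact ((continuous_ofReal.tendsto _).comp hre).add
    (((continuous_ofReal.tendsto _).comp him).mul_const _)

theorem tendsto_integral_of_tendsto_integral_pow {σn : ℕ → Measure Circle} {σ : Measure Circle}
    [∀ n, IsFiniteMeasure (σn n)] [IsFiniteMeasure σ] {C : ℝ}
    (hC : ∀ᶠ n in atTop, (σn n).real Set.univ ≤ C)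
    (h : ∀ m : ℕ, Tendsto (fun n => ∫ ζ : Circle, (ζ : ℂ) ^ m ∂(σn n)) atTop
      (𝓝 (∫ ζ : Circle, (ζ : ℂ) ^ m ∂σ))) (f : C(Circle, ℝ)) :
    Tendsto (fun n => ∫ ζ, f ζ ∂(σn n)) atTop (𝓝 (∫ ζ, f ζ ∂σ)) := by
  have : Fact (0 < 2 * Real.pi) := ⟨by positivity⟩
  let e : AddCircle (2 * Real.pi) ≃ₜ Circle := AddCircle.homeomorphCircle (by positivity)
  have hspan : ∀ p ∈ Submodule.span ℂ (Set.range (@fourier (2 * Real.pi))),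
      Tendsto (fun n => ∫ ζ, p (e.symm ζ) ∂(σn n)) atTop (𝓝 (∫ ζ, p (e.symm ζ) ∂σ)) := by
    intro p hp
    have hint : ∀ (q : C(AddCircle (2 * Real.pi), ℂ)) (ν : Measure Circle) [IsFiniteMeasure ν],
        Integrable (fun ζ => q (e.symm ζ)) ν := fun q ν _ =>
      Continuous.integrable_circle (by fun_prop) ν
    induction hp using Submodule.span_induction with
    | mem x hx =>
      obtain ⟨k, rfl⟩ := hx
      have hk : ∀ (k : ℕ) ζ, fourier (k : ℤ) (e.symm ζ) = (ζ : ℂ) ^ k := by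
        intro k ζ
        have h1 : AddCircle.toCircle (e.symm ζ) = ζ := by
          rw [← AddCircle.homeomorphCircle_apply (by positivity)]
          exact e.apply_symm_apply ζ
        rw [fourier_apply, AddCircle.toCircle_zsmul, h1]
        simp
      obtain ⟨k, rfl | rfl⟩ := k.eq_nat_or_neg
      · simp only [hk]
        exact h k
      · simp only [fourier_neg, hk, integral_conj]
        exact (continuous_conj.tendsto _).comp (h k)
    | zero => simp
    | add x y _ _ hx hy =>
      simp only [ContinuousMap.add_apply, integral_add (hint x _) (hint y _)]
      exact hx.add hy
    | smul a x _ hx =>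
      simp only [ContinuousMap.smul_apply, integral_smul]
      exact hx.const_smul a
  have hmain : Tendsto (fun n => ∫ ζ, (f ζ : ℂ) ∂(σn n)) atTop (𝓝 (∫ ζ, (f ζ : ℂ) ∂σ)) := by
    refine tendsto_integral_of_uniform_approx hC (by fun_prop) fun ε hε => ?_
    let g : C(AddCircle (2 * Real.pi), ℂ) := ⟨fun x => (f (e x) : ℂ), by fun_prop⟩
    have hg : g ∈ closure
        (Submodule.span ℂ (Set.range (@fourier (2 * Real.pi))) : Set C(AddCircle (2 * Real.pi), ℂ)) := by
      rw [← Submodule.topologicalClosure_coe, span_fourier_closure_eq_top]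
      trivial
    obtain ⟨p, hp, hgp⟩ := Metric.mem_closure_iff.1 hg ε hε
    refine ⟨fun ζ => p (e.symm ζ), by fun_prop, fun ζ => ?_, hspan p hp⟩
    have := (ContinuousMap.dist_apply_le_dist (f := g) (g := p) (e.symm ζ)).trans hgp.le
    simpa [g, dist_eq_norm] using this
  simp only [integral_complex_ofReal] at hmain
  simpa [Function.comp_def] using (continuous_re.tendsto _).comp hmain

theorem abs_sin_sub_truncation_le {τ : ℝ} (hτ : 0 < τ) (hτ' : τ < Real.pi) {θ β : ℝ}
    (hθ : |θ| ≤ Real.pi) (hβ : |β| ≤ τ / 2) (hβ' : |β| ≤ (Real.pi - τ) / 2) :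
    |Real.sin (θ - β) - ((if |θ| < τ then θ else 0) - β)| ≤
      (Real.pi ^ 2 + 6 * Real.pi ^ 2 / τ ^ 2) * (1 - Real.cos (θ - β)) := by
  have hπ : 0 < Real.pi := Real.pi_pos
  have hcos : 0 ≤ 1 - Real.cos (θ - β) := sub_nonneg.2 (Real.cos_le_one _)
  have hx : |θ - β| ≤ |θ| + |β| := abs_sub _ _
  have hx' : |θ| - |β| ≤ |θ - β| := abs_sub_abs_le_abs_sub _ _
  split_ifs with h
  · have h1 : Real.cos (θ - β) ≤ 1 - 2 / Real.pi ^ 2 * (θ - β) ^ 2 :=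
      Real.cos_le_one_sub_mul_cos_sq (by linarith)
    generalize θ - β = x at *
    have h2 : 2 * x ^ 2 ≤ Real.pi ^ 2 * (1 - Real.cos x) := by
      have : Real.pi ^ 2 * (2 / Real.pi ^ 2 * x ^ 2) = 2 * x ^ 2 := by field_simp
      nlinarith [sq_nonneg Real.pi]
    have h3 : |Real.sin x - x| ≤ 2 * x ^ 2 := by
      rcases le_total |x| 1 with hx1 | hx1
      · have := Real.sin_bound hx1
        have h4 : |Real.sin x - x| ≤ |Real.sin x - (x - x ^ 3 / 6)| + |x ^ 3 / 6| := by
          have : Real.sin x - x = (Real.sin x - (x - x ^ 3 / 6)) - x ^ 3 / 6 := by ring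
          rw [this]
          exact abs_sub _ _
        rw [abs_div, abs_pow, abs_of_pos (by norm_num : (0 : ℝ) < 6)] at h4
        rw [← sq_abs x]
        have h5 : |x| ^ 3 ≤ |x| ^ 2 := pow_le_pow_of_le_one (abs_nonneg _) hx1 (by norm_num)
        have h6 : |x| ^ 5 ≤ |x| ^ 2 := pow_le_pow_of_le_one (abs_nonneg _) hx1 (by norm_num)
        nlinarith [sq_nonneg |x|]
      · have h4 : |Real.sin x - x| ≤ |Real.sin x| + |x| := abs_sub _ _
        have h5 : |Real.sin x| ≤ |x| := Real.abs_sin_le_abs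
        rw [← sq_abs x]
        nlinarith
    have h4 : 0 ≤ 6 * Real.pi ^ 2 / τ ^ 2 * (1 - Real.cos x) := by positivity
    linarith
  · push Not at h
    have h1 : τ ^ 2 / (2 * Real.pi ^ 2) ≤ 1 - Real.cos (θ - β) := by
      rcases le_total |θ - β| Real.pi with hx1 | hx1
      · have h1 := Real.cos_le_one_sub_mul_cos_sq hx1
        have h2 : (τ / 2) ^ 2 ≤ (θ - β) ^ 2 := by
          rw [← sq_abs (θ - β)]
          exact pow_le_pow_left₀ (by positivity) (by linarith) 2
        have h3 : τ ^ 2 / (2 * Real.pi ^ 2) = 2 / Real.pi ^ 2 * (τ / 2) ^ 2 := by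
          field_simp
        have h4 : 2 / Real.pi ^ 2 * (τ / 2) ^ 2 ≤ 2 / Real.pi ^ 2 * (θ - β) ^ 2 := by gcongr
        linarith
      · have h1 : Real.cos |θ - β| ≤ 0 :=
          Real.cos_nonpos_of_pi_div_two_le_of_le (by linarith) (by linarith)
        rw [Real.cos_abs] at h1
        have h2 : τ ^ 2 / (2 * Real.pi ^ 2) ≤ 1 := by
          rw [div_le_one (by positivity)]
          nlinarith
        linarith
    have h2 : |Real.sin (θ - β) - (0 - β)| ≤ 3 := by
      have h3 := abs_add_le (Real.sin (θ - β)) β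
      have h4 := Real.abs_sin_le_one (θ - β)
      have h5 := Real.pi_le_four
      rw [zero_sub, sub_neg_eq_add]
      linarith
    have h3 : 6 * Real.pi ^ 2 / τ ^ 2 * (τ ^ 2 / (2 * Real.pi ^ 2)) = 3 := by
      field_simp
      norm_num
    have h4 : 6 * Real.pi ^ 2 / τ ^ 2 * (τ ^ 2 / (2 * Real.pi ^ 2)) ≤
        6 * Real.pi ^ 2 / τ ^ 2 * (1 - Real.cos (θ - β)) := by gcongr
    have h5 : 0 ≤ Real.pi ^ 2 * (1 - Real.cos (θ - β)) := by positivity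
    linarith

theorem abs_arg_coe_circle_le (ζ : Circle) : |arg (ζ : ℂ)| ≤ 2 * ‖(ζ : ℂ) - 1‖ := by
  have h1 : ‖(ζ : ℂ) - 1‖ = |2 * Real.sin (arg (ζ : ℂ) / 2)| := by
    conv_lhs => rw [← Circle.exp_arg ζ, Circle.coe_exp, mul_comm]
    rw [norm_exp_I_mul_ofReal_sub_one, Real.norm_eq_abs]
  have h2 := Real.mul_abs_le_abs_sin (x := arg (ζ : ℂ) / 2) (by
    rw [abs_div, abs_two]
    linarith [abs_arg_le_pi (ζ : ℂ)])
  rw [abs_div, abs_two] at h2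
  rw [h1, abs_mul, abs_two]
  have h3 : 2 / Real.pi * (|arg (ζ : ℂ)| / 2) = |arg (ζ : ℂ)| / Real.pi := by
    field_simp
  rw [h3, div_le_iff₀ Real.pi_pos] at h2
  nlinarith [Real.pi_le_four, abs_nonneg (Real.sin (arg (ζ : ℂ) / 2))]

theorem measurable_arg_circle : Measurable fun ζ : Circle => arg (ζ : ℂ) :=
  measurable_arg.comp (by fun_prop : Continuous fun ζ : Circle => (ζ : ℂ)).measurable

theorem integrable_truncated_arg (τ : ℝ) (μ : Measure Circle) [IsFiniteMeasure μ] :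
    Integrable (fun ζ : Circle => if |arg (ζ : ℂ)| < τ then arg (ζ : ℂ) else 0) μ := by
  refine Integrable.of_bound (C := Real.pi) ?_ (.of_forall fun ζ => ?_)
  · exact (Measurable.ite (measurableSet_lt measurable_arg_circle.abs measurable_const)
      measurable_arg_circle measurable_const).aestronglyMeasurable
  · split_ifs
    · exact abs_arg_le_pi _
    · simp [Real.pi_pos.le]

theorem betaT_eq (τ : ℝ) (μ : Measure Circle) :
    betaT τ μ = ∫ ζ : Circle, (if |arg (ζ : ℂ)| < τ then arg (ζ : ℂ) else 0) ∂μ := by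
  rw [betaT, ← integral_indicator (measurableSet_lt measurable_arg_circle.abs measurable_const)]
  rfl

theorem abs_betaT_le (τ : ℝ) (μ : Measure Circle) [IsFiniteMeasure μ] :
    |betaT τ μ| ≤ 2 * ∫ ζ : Circle, ‖(ζ : ℂ) - 1‖ ∂μ := by
  rw [betaT_eq, ← integral_const_mul, ← Real.norm_eq_abs]
  refine norm_integral_le_of_norm_le (Continuous.integrable_circle (by fun_prop) μ)
    (.of_forall fun ζ => ?_)
  split_ifs
  · exact abs_arg_coe_circle_le ζ
  · simp

instance isProbabilityMeasure_centerT (τ : ℝ) (μ : Measure Circle) [IsProbabilityMeasure μ] :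
    IsProbabilityMeasure (centerT τ μ) :=
  Measure.isProbabilityMeasure_map
    (by fun_prop : Continuous fun ζ : Circle => (bT τ μ)⁻¹ * ζ).measurable.aemeasurable

theorem integral_centerT {E : Type*} [NormedAddCommGroup E] [NormedSpace ℝ E] (τ : ℝ)
    (μ : Measure Circle) {f : Circle → E} (hf : Continuous f) :
    ∫ ζ, f ζ ∂(centerT τ μ) = ∫ ζ, f ((bT τ μ)⁻¹ * ζ) ∂μ :=
  integral_map (by fun_prop : Continuous fun ζ : Circle => (bT τ μ)⁻¹ * ζ).measurable.aemeasurable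
    hf.aestronglyMeasurable

theorem bT_inv_mul (τ : ℝ) (μ : Measure Circle) (ζ : Circle) :
    (bT τ μ)⁻¹ * ζ = Circle.exp (arg (ζ : ℂ) - betaT τ μ) := by
  rw [Circle.exp_sub, Circle.exp_arg, bT, div_eq_inv_mul]

theorem norm_bT_sub_one_le (τ : ℝ) (μ : Measure Circle) [IsFiniteMeasure μ] :
    ‖(bT τ μ : ℂ) - 1‖ ≤ 2 * ∫ ζ : Circle, ‖(ζ : ℂ) - 1‖ ∂μ := by
  rw [bT, Circle.coe_exp, mul_comm]
  exact Real.norm_exp_I_mul_ofReal_sub_one_le.trans (abs_betaT_le τ μ)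

theorem integral_norm_sub_one_centerT_le (τ : ℝ) (μ : Measure Circle) [IsProbabilityMeasure μ] :
    ∫ ζ : Circle, ‖(ζ : ℂ) - 1‖ ∂(centerT τ μ) ≤ 3 * ∫ ζ : Circle, ‖(ζ : ℂ) - 1‖ ∂μ := by
  have hc : Continuous fun ζ : Circle => ‖(ζ : ℂ) - 1‖ := by fun_prop
  rw [integral_centerT τ μ hc]
  have h1 : ∫ ζ : Circle, ‖(((bT τ μ)⁻¹ * ζ : Circle) : ℂ) - 1‖ ∂μ ≤
      ∫ ζ : Circle, (‖(ζ : ℂ) - 1‖ + ‖(bT τ μ : ℂ) - 1‖) ∂μ := by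
    refine integral_mono (Continuous.integrable_circle (by fun_prop) μ)
      (Continuous.integrable_circle (by fun_prop) μ) fun ζ => ?_
    have h2 : (((bT τ μ)⁻¹ * ζ : Circle) : ℂ) - 1 = (bT τ μ : ℂ)⁻¹ * (ζ - bT τ μ) := by
      have := (bT τ μ).coe_ne_zero
      rw [Circle.coe_mul, Circle.coe_inv]
      field_simp
    have h3 : (ζ : ℂ) - bT τ μ = (ζ - 1) - (bT τ μ - 1) := by ring
    simp only [h2]
    rw [norm_mul, norm_inv, Circle.norm_coe, inv_one, one_mul, h3]
    exact norm_sub_le _ _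
  rw [integral_add (hc.integrable_circle μ) (integrable_const _)] at h1
  have h4 := norm_bT_sub_one_le τ μ
  simp only [integral_const, probReal_univ, one_smul] at h1
  linarith

theorem integral_one_sub_re_nonneg (ν : Measure Circle) :
    0 ≤ ∫ ζ : Circle, (1 - (ζ : ℂ).re) ∂ν :=
  integral_nonneg fun ζ => by
    have := (re_le_norm (ζ : ℂ)).trans_eq (Circle.norm_coe ζ)
    simpa using this

theorem integral_one_sub_re_le (ν : Measure Circle) [IsFiniteMeasure ν] :
    ∫ ζ : Circle, (1 - (ζ : ℂ).re) ∂ν ≤ ∫ ζ : Circle, ‖(ζ : ℂ) - 1‖ ∂ν := by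
  refine integral_mono (Continuous.integrable_circle (by fun_prop) ν)
      (Continuous.integrable_circle (by fun_prop) ν) fun ζ => ?_
  have := re_le_norm (1 - (ζ : ℂ))
  simp only
  rw [norm_sub_rev]
  simpa using this

/-- After centering, the imaginary part of the first moment is controlled by the defect of its
real part. -/
theorem abs_integral_im_centerT_le {τ : ℝ} (hτ : 0 < τ) (hτ' : τ < Real.pi) (μ : Measure Circle)
    [IsProbabilityMeasure μ] (hβ : |betaT τ μ| ≤ τ / 2) (hβ' : |betaT τ μ| ≤ (Real.pi - τ) / 2) :
    |∫ ζ : Circle, (ζ : ℂ).im ∂(centerT τ μ)| ≤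
      (Real.pi ^ 2 + 6 * Real.pi ^ 2 / τ ^ 2) *
        ∫ ζ : Circle, (1 - (ζ : ℂ).re) ∂(centerT τ μ) := by
  have hc : Continuous fun ζ : Circle => (ζ : ℂ).im := by fun_prop
  have hc' : Continuous fun ζ : Circle => 1 - (ζ : ℂ).re := by fun_prop
  rw [integral_centerT τ μ hc, integral_centerT τ μ hc']
  have h1 : ∫ ζ : Circle, (((bT τ μ)⁻¹ * ζ : Circle) : ℂ).im ∂μ =
      ∫ ζ : Circle, ((((bT τ μ)⁻¹ * ζ : Circle) : ℂ).im
        - ((if |arg (ζ : ℂ)| < τ then arg (ζ : ℂ) else 0) - betaT τ μ)) ∂μ := by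
    have h2 : Integrable (fun ζ : Circle => (((bT τ μ)⁻¹ * ζ : Circle) : ℂ).im) μ :=
      Continuous.integrable_circle (by fun_prop) μ
    have h3 : Integrable (fun ζ : Circle =>
        (if |arg (ζ : ℂ)| < τ then arg (ζ : ℂ) else 0) - betaT τ μ) μ :=
      (integrable_truncated_arg τ μ).sub (integrable_const _)
    rw [integral_sub h2 h3, integral_sub (integrable_truncated_arg τ μ) (integrable_const _), ← betaT_eq]
    simp
  rw [h1, ← integral_const_mul, ← Real.norm_eq_abs]
  refine norm_integral_le_of_norm_le (Continuous.integrable_circle (by fun_prop) μ)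
    (.of_forall fun ζ => ?_)
  rw [bT_inv_mul, Circle.coe_exp, exp_ofReal_mul_I_im, exp_ofReal_mul_I_re]
  exact abs_sin_sub_truncation_le hτ hτ' (abs_arg_le_pi _) hβ hβ'

theorem continuous_div_one_sub {f : Circle → ℂ} (hf : Continuous f) {z : ℂ} (hz : ‖z‖ < 1) :
    Continuous fun ζ : Circle => f ζ / (1 - (ζ : ℂ) * z) :=
  hf.div (by fun_prop) fun ζ => one_sub_circle_mul_ne_zero ζ hz

theorem BT_eq_div (μ : Measure Circle) [IsProbabilityMeasure μ] {z : ℂ} (hz : ‖z‖ < 1) :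
    BT μ z = (∫ ζ : Circle, (ζ : ℂ) / (1 - (ζ : ℂ) * z) ∂μ) /
      ∫ ζ : Circle, 1 / (1 - (ζ : ℂ) * z) ∂μ := by
  rw [BT]
  split_ifs with h
  · simp [h]
  · have h1 : psiT μ z = z * ∫ ζ : Circle, (ζ : ℂ) / (1 - (ζ : ℂ) * z) ∂μ := by
      rw [psiT, ← integral_const_mul]
      congr 1
      ext ζ
      ring
    have h2 : 1 + psiT μ z = ∫ ζ : Circle, 1 / (1 - (ζ : ℂ) * z) ∂μ := by
      have h3 : Integrable (fun ζ : Circle => ((ζ : ℂ) * z) / (1 - (ζ : ℂ) * z)) μ :=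
        (continuous_div_one_sub (by fun_prop) hz).integrable_circle μ
      have h4 : (1 : ℂ) + psiT μ z = ∫ _ : Circle, (1 : ℂ) ∂μ + psiT μ z := by simp
      rw [h4, psiT, ← integral_add (integrable_const _) h3]
      congr 1
      ext ζ
      have := one_sub_circle_mul_ne_zero ζ hz
      rw [one_add_div this]
      ring
    rw [h2, h1]
    field_simp

/-- The exponent `hT`, with the centered measure replaced by an arbitrary one. -/
def herglotzExponent (ν : Measure Circle) (z : ℂ) : ℂ :=
  -Complex.I * ((∫ ζ : Circle, ((ζ : ℂ)).im ∂ν : ℝ) : ℂ) +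
    ∫ ζ : Circle, ((1 + (ζ : ℂ) * z) / (1 - (ζ : ℂ) * z)) * ((1 - ((ζ : ℂ)).re : ℝ) : ℂ) ∂ν

theorem herglotz_identity (ζ : Circle) {z : ℂ} (hz : ‖z‖ < 1) :
    -I * (((ζ : ℂ).im : ℝ) : ℂ) +
      ((1 + (ζ : ℂ) * z) / (1 - (ζ : ℂ) * z)) * ((1 - ((ζ : ℂ)).re : ℝ) : ℂ) =
    (1 - z) * ((1 - (ζ : ℂ)) / (1 - (ζ : ℂ) * z)) := by
  have hx := one_sub_circle_mul_ne_zero ζ hz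
  have h1 : (((ζ : ℂ).re : ℝ) : ℂ) = (ζ + (ζ : ℂ)⁻¹) / 2 := by
    rw [re_eq_add_conj, ← Circle.coe_inv_eq_conj, Circle.coe_inv]
  have h2 : -I * (((ζ : ℂ).im : ℝ) : ℂ) = -(ζ - (ζ : ℂ)⁻¹) / 2 := by
    rw [im_eq_sub_conj, ← Circle.coe_inv_eq_conj, Circle.coe_inv]
    field_simp
  have hζ := ζ.coe_ne_zero
  rw [h2, ofReal_sub, h1, ofReal_one]
  generalize (ζ : ℂ) = x at *
  field_simp
  ring

theorem continuous_herglotz_kernel {z : ℂ} (hz : ‖z‖ < 1) :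
    Continuous fun ζ : Circle => (1 + (ζ : ℂ) * z) / (1 - (ζ : ℂ) * z) :=
  continuous_div_one_sub (by fun_prop) hz

theorem continuous_herglotz_kernel_mul {z : ℂ} (hz : ‖z‖ < 1) :
    Continuous fun ζ : Circle =>
      (1 + (ζ : ℂ) * z) / (1 - (ζ : ℂ) * z) * ((1 - ((ζ : ℂ)).re : ℝ) : ℂ) :=
  (continuous_herglotz_kernel hz).mul (by fun_prop)

theorem herglotzExponent_eq (ν : Measure Circle) [IsFiniteMeasure ν] {z : ℂ} (hz : ‖z‖ < 1) :
    herglotzExponent ν z = (1 - z) * ∫ ζ : Circle, (1 - (ζ : ℂ)) / (1 - (ζ : ℂ) * z) ∂ν := by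
  have h1 : Integrable (fun ζ : Circle => -I * (((ζ : ℂ).im : ℝ) : ℂ)) ν :=
    Continuous.integrable_circle (by fun_prop) ν
  rw [herglotzExponent, ← integral_complex_ofReal, ← integral_const_mul, ← integral_const_mul,
    ← integral_add h1 ((continuous_herglotz_kernel_mul hz).integrable_circle ν)]
  exact integral_congr_ae (.of_forall fun ζ => herglotz_identity ζ hz)

theorem norm_one_sub_mul_integral_sub_one_le (ν : Measure Circle) [IsProbabilityMeasure ν]
    {w : ℂ} (hw : ‖w‖ < 1) :
    ‖(1 - w) * ∫ ζ : Circle, 1 / (1 - (ζ : ℂ) * w) ∂ν - 1‖ ≤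
      1 / (1 - ‖w‖) * ∫ ζ : Circle, ‖(ζ : ℂ) - 1‖ ∂ν := by
  have h1 : (1 - w) * ∫ ζ : Circle, 1 / (1 - (ζ : ℂ) * w) ∂ν - 1 =
      ∫ ζ : Circle, ((1 - w) * (1 / (1 - (ζ : ℂ) * w)) - 1) ∂ν := by
    have h3 : Integrable (fun ζ : Circle => (1 - w) * (1 / (1 - (ζ : ℂ) * w))) ν :=
      ((continuous_div_one_sub (by fun_prop) hw).const_mul _).integrable_circle ν
    rw [integral_sub h3 (integrable_const _), integral_const_mul]
    simp
  rw [h1, ← integral_const_mul]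
  refine norm_integral_le_of_norm_le (Continuous.integrable_circle (by fun_prop) ν)
    (.of_forall fun ζ => ?_)
  have hx := one_sub_circle_mul_ne_zero ζ hw
  have hx' := one_sub_norm_le ζ w
  have h2 : (1 - w) * (1 / (1 - (ζ : ℂ) * w)) - 1 = w * (ζ - 1) / (1 - (ζ : ℂ) * w) := by
    rw [mul_one_div, div_sub_one hx]
    ring
  have h0 : 0 < 1 - ‖w‖ := by linarith
  rw [h2, norm_div, norm_mul, div_eq_mul_inv, one_div, mul_comm]
  gcongr
  exact mul_le_of_le_one_left (norm_nonneg _) hw.le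

theorem norm_herglotzExponent_le (ν : Measure Circle) [IsFiniteMeasure ν] {z : ℂ} (hz : ‖z‖ < 1)
    {C : ℝ} (hC : |∫ ζ : Circle, (ζ : ℂ).im ∂ν| ≤ C * ∫ ζ : Circle, (1 - (ζ : ℂ).re) ∂ν) :
    ‖herglotzExponent ν z‖ ≤ (C + 2 / (1 - ‖z‖)) * ∫ ζ : Circle, (1 - (ζ : ℂ).re) ∂ν := by
  rw [herglotzExponent, add_mul]
  refine (norm_add_le _ _).trans (add_le_add ?_ ?_)
  · simpa using hC
  · rw [← integral_const_mul]
    refine norm_integral_le_of_norm_le (Continuous.integrable_circle (by fun_prop) ν)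
      (.of_forall fun ζ => ?_)
    have hx' := one_sub_norm_le ζ z
    have h0 : 0 < 1 - ‖z‖ := by linarith
    have h1 : 0 ≤ 1 - (ζ : ℂ).re := by
      simpa using (re_le_norm (ζ : ℂ)).trans_eq (Circle.norm_coe ζ)
    rw [norm_mul, norm_div, norm_real, Real.norm_eq_abs, abs_of_nonneg h1]
    gcongr
    refine (norm_add_le _ _).trans ?_
    rw [norm_coe_circle_mul, norm_one]
    linarith

theorem norm_herglotzExponent_sub_le (ν : Measure Circle) [IsFiniteMeasure ν] {z w : ℂ}
    (hz : ‖z‖ < 1) (hw : ‖w‖ = ‖z‖) :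
    ‖herglotzExponent ν w - herglotzExponent ν z‖ ≤
      2 * ‖w - z‖ / (1 - ‖z‖) ^ 2 * ∫ ζ : Circle, (1 - (ζ : ℂ).re) ∂ν := by
  have hw' : ‖w‖ < 1 := hw ▸ hz
  rw [herglotzExponent, herglotzExponent, add_sub_add_left_eq_sub,
    ← integral_sub ((continuous_herglotz_kernel_mul hw').integrable_circle ν)
      ((continuous_herglotz_kernel_mul hz).integrable_circle ν), ← integral_const_mul]
  refine norm_integral_le_of_norm_le (Continuous.integrable_circle (by fun_prop) ν)
    (.of_forall fun ζ => ?_)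
  have h0 : 0 < 1 - ‖z‖ := by linarith
  have h1 : 0 ≤ 1 - (ζ : ℂ).re := by
    simpa using (re_le_norm (ζ : ℂ)).trans_eq (Circle.norm_coe ζ)
  have hxz := one_sub_norm_le ζ z
  have hxw := one_sub_norm_le ζ w
  rw [hw] at hxw
  have hz0 := one_sub_circle_mul_ne_zero ζ hz
  have hw0 := one_sub_circle_mul_ne_zero ζ hw'
  have h2 : (1 + (ζ : ℂ) * w) / (1 - (ζ : ℂ) * w) - (1 + (ζ : ℂ) * z) / (1 - (ζ : ℂ) * z) =
      ζ * (2 * (w - z)) / ((1 - (ζ : ℂ) * w) * (1 - (ζ : ℂ) * z)) := by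
    field_simp
    ring
  rw [← sub_mul, h2, norm_mul, norm_real, Real.norm_eq_abs, abs_of_nonneg h1, norm_div,
    norm_coe_circle_mul, norm_mul, norm_mul, RCLike.norm_ofNat, sq]
  gcongr

theorem exists_exp_error {h h' u v : ℂ} {K L s d : ℝ} (hu : u * (1 + v) = h') (hv : ‖v‖ ≤ L * d)
    (hLd : L * d ≤ 1 / 2) (hh' : ‖h'‖ ≤ K * s) (hd : ‖h' - h‖ ≤ L * d * s) (hs : 0 ≤ s)
    (hsd : s ≤ 3 * d) (hK : 0 ≤ K) (hKs : K * s ≤ 1 / 4) :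
    ∃ E : ℂ, 1 - u = exp (-h + E) ∧ ‖E‖ ≤ (12 * K ^ 2 + 2 * K * L + L) * d * s := by
  have h1 : (1 / 2 : ℝ) ≤ ‖1 + v‖ := by
    have := norm_sub_le (1 + v) v
    rw [add_sub_cancel_right, norm_one] at this
    linarith
  have hu1 : ‖u‖ ≤ 2 * K * s := by
    rw [← hu, norm_mul] at hh'
    nlinarith [norm_nonneg u]
  have hu2 : ‖u‖ ≤ 1 / 2 := by linarith
  have hne : 1 - u ≠ 0 := by
    intro h0
    have : u = 1 := (sub_eq_zero.1 h0).symm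
    rw [this, norm_one] at hu2
    norm_num at hu2
  refine ⟨log (1 - u) + h, ?_, ?_⟩
  · rw [show -h + (log (1 - u) + h) = log (1 - u) by ring, exp_log hne]
  · have h2 : ‖log (1 - u) + u‖ ≤ ‖u‖ ^ 2 := by
      have h3 := norm_log_one_add_sub_self_le (z := -u) (by rw [norm_neg]; linarith)
      rw [norm_neg, sub_neg_eq_add, ← sub_eq_add_neg] at h3
      refine h3.trans ?_
      have h4 : (1 - ‖u‖)⁻¹ ≤ 2 := by
        rw [inv_le_comm₀ (by linarith) (by norm_num)]
        linarith
      nlinarith [sq_nonneg ‖u‖]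
    have h3 : ‖h' - u‖ ≤ 2 * K * s * (L * d) := by
      rw [← hu, show u * (1 + v) - u = u * v by ring, norm_mul]
      gcongr
    have h4 : log (1 - u) + h = (log (1 - u) + u) + (h' - u) - (h' - h) := by ring
    have h5 : ‖u‖ ^ 2 ≤ 12 * K ^ 2 * d * s := by
      have h6 : ‖u‖ ^ 2 ≤ (2 * K * s) ^ 2 := pow_le_pow_left₀ (norm_nonneg _) hu1 2
      have h7 : K ^ 2 * s * s ≤ K ^ 2 * s * (3 * d) := by gcongr
      linarith
    rw [h4]
    have h6 := norm_sub_le ((log (1 - u) + u) + (h' - u)) (h' - h)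
    have h7 := norm_add_le (log (1 - u) + u) (h' - u)
    linarith

theorem BT_eq_bT_mul (τ : ℝ) (μ : Measure Circle) [IsProbabilityMeasure μ] {z w : ℂ}
    (hz : ‖z‖ < 1) (hw : w = bT τ μ * z)
    (hD : ∫ ζ : Circle, 1 / (1 - (ζ : ℂ) * w) ∂(centerT τ μ) ≠ 0) :
    BT μ z = bT τ μ * (1 - (∫ ζ : Circle, (1 - (ζ : ℂ)) / (1 - (ζ : ℂ) * w) ∂(centerT τ μ)) /
      ∫ ζ : Circle, 1 / (1 - (ζ : ℂ) * w) ∂(centerT τ μ)) := by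
  have hb := (bT τ μ).coe_ne_zero
  have hw1 : ‖w‖ < 1 := by rwa [hw, norm_coe_circle_mul]
  have hrot : ∀ ζ : Circle, (((bT τ μ)⁻¹ * ζ : Circle) : ℂ) * w = ζ * z := by
    intro ζ
    rw [hw, Circle.coe_mul, Circle.coe_inv]
    field_simp
  have h1 : ∫ ζ : Circle, 1 / (1 - (ζ : ℂ) * w) ∂(centerT τ μ) =
      ∫ ζ : Circle, 1 / (1 - (ζ : ℂ) * z) ∂μ := by
    rw [integral_centerT τ μ (continuous_div_one_sub continuous_const hw1)]
    simp only [hrot]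
  have h2 : ∫ ζ : Circle, (1 - (ζ : ℂ)) / (1 - (ζ : ℂ) * w) ∂(centerT τ μ) =
      ∫ ζ : Circle, 1 / (1 - (ζ : ℂ) * w) ∂(centerT τ μ)
        - (bT τ μ : ℂ)⁻¹ * ∫ ζ : Circle, (ζ : ℂ) / (1 - (ζ : ℂ) * z) ∂μ := by
    have h3 : (bT τ μ : ℂ)⁻¹ * ∫ ζ : Circle, (ζ : ℂ) / (1 - (ζ : ℂ) * z) ∂μ =
        ∫ ζ : Circle, (ζ : ℂ) / (1 - (ζ : ℂ) * w) ∂(centerT τ μ) := by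
      rw [integral_centerT τ μ (continuous_div_one_sub (by fun_prop) hw1), ← integral_const_mul]
      simp only [hrot]
      simp only [Circle.coe_mul, Circle.coe_inv, mul_div_assoc]
    have h4 := (continuous_div_one_sub (continuous_const (y := (1 : ℂ))) hw1).integrable_circle
      (centerT τ μ)
    have h5 := (continuous_div_one_sub (f := fun ζ => (ζ : ℂ)) (by fun_prop) hw1).integrable_circle
      (centerT τ μ)
    rw [h3, ← integral_sub h4 h5]
    simp only [sub_div]
  rw [BT_eq_div μ hz, h2, ← h1]
  generalize ∫ ζ : Circle, 1 / (1 - (ζ : ℂ) * w) ∂(centerT τ μ) = D at *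
  generalize ∫ ζ : Circle, (ζ : ℂ) / (1 - (ζ : ℂ) * z) ∂μ = N
  field_simp
  ring

theorem exists_BT_eq_exp {τ : ℝ} (hτ : 0 < τ) (hτ' : τ < Real.pi) {z : ℂ} (hz : ‖z‖ < 1) :
    ∃ K > 0, ∃ δ > 0, ∀ (μ : Measure Circle) [IsProbabilityMeasure μ],
      ∫ ζ : Circle, ‖(ζ : ℂ) - 1‖ ∂μ ≤ δ → ∃ E : ℂ, BT μ z = bT τ μ * exp (-hT τ μ z + E) ∧
        ‖E‖ ≤ K * (∫ ζ : Circle, ‖(ζ : ℂ) - 1‖ ∂μ) *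
          ∫ ζ : Circle, (1 - (ζ : ℂ).re) ∂(centerT τ μ) := by
  set C := Real.pi ^ 2 + 6 * Real.pi ^ 2 / τ ^ 2 with hC
  have hπ := Real.pi_pos
  have hC0 : 0 < C := by positivity
  have h0 : 0 < 1 - ‖z‖ := by linarith
  set M := C + 2 / (1 - ‖z‖) with hM
  have hM0 : 0 < M := by positivity
  set L := 3 / (1 - ‖z‖) + 4 / (1 - ‖z‖) ^ 2 with hL
  have hL0 : 0 < L := by positivity
  refine ⟨12 * M ^ 2 + 2 * M * L + L, by positivity,
    min (min (1 / (2 * L)) (1 / (12 * M))) (min (τ / 4) ((Real.pi - τ) / 4)), ?_, ?_⟩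
  · have : 0 < Real.pi - τ := by linarith
    positivity
  intro μ _ hd
  set d := ∫ ζ : Circle, ‖(ζ : ℂ) - 1‖ ∂μ with hd_def
  have hd0 : 0 ≤ d := integral_nonneg fun ζ => norm_nonneg _
  simp only [le_min_iff] at hd
  obtain ⟨⟨hd1, hd2⟩, hd3, hd4⟩ := hd
  set w : ℂ := bT τ μ * z with hw
  have hwz : ‖w‖ = ‖z‖ := norm_coe_circle_mul _ _
  have hw1 : ‖w‖ < 1 := hwz ▸ hz
  set ν := centerT τ μ with hν
  set s := ∫ ζ : Circle, (1 - (ζ : ℂ).re) ∂ν with hs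
  have hs0 : 0 ≤ s := integral_one_sub_re_nonneg ν
  have hν3 : ∫ ζ : Circle, ‖(ζ : ℂ) - 1‖ ∂ν ≤ 3 * d := integral_norm_sub_one_centerT_le τ μ
  have hs3 : s ≤ 3 * d := (integral_one_sub_re_le ν).trans hν3
  have hβ := abs_betaT_le τ μ
  have him := abs_integral_im_centerT_le hτ hτ' μ (by linarith) (by linarith)
  have hLd : L * d ≤ 1 / 2 := by
    rw [le_div_iff₀ (by positivity)] at hd1
    linarith
  have hMs : M * s ≤ 1 / 4 := by
    rw [le_div_iff₀ (by positivity)] at hd2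
    nlinarith
  set D := ∫ ζ : Circle, 1 / (1 - (ζ : ℂ) * w) ∂ν with hD
  have hv : ‖(1 - w) * D - 1‖ ≤ L * d := by
    refine (norm_one_sub_mul_integral_sub_one_le ν hw1).trans ?_
    rw [hwz]
    have h1 : 1 / (1 - ‖z‖) * ∫ ζ : Circle, ‖(ζ : ℂ) - 1‖ ∂ν ≤ 1 / (1 - ‖z‖) * (3 * d) := by
      gcongr
    have h2 : 1 / (1 - ‖z‖) * (3 * d) = 3 / (1 - ‖z‖) * d := by ring
    have h3 : 0 ≤ 4 / (1 - ‖z‖) ^ 2 * d := by positivity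
    rw [hL, add_mul]
    linarith
  have hD0 : D ≠ 0 := by
    intro h
    rw [h, mul_zero, zero_sub, norm_neg, norm_one] at hv
    linarith
  have hdiff : ‖herglotzExponent ν w - herglotzExponent ν z‖ ≤ L * d * s := by
    refine (norm_herglotzExponent_sub_le ν hz hwz).trans ?_
    have h1 : ‖w - z‖ ≤ 2 * d := by
      rw [hw, show (bT τ μ : ℂ) * z - z = (bT τ μ - 1) * z by ring, norm_mul]
      exact (mul_le_of_le_one_right (norm_nonneg _) hz.le).trans (norm_bT_sub_one_le τ μ)
    have h2 : 2 * ‖w - z‖ / (1 - ‖z‖) ^ 2 ≤ 2 * (2 * d) / (1 - ‖z‖) ^ 2 := by gcongr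
    have h3 : 2 * (2 * d) / (1 - ‖z‖) ^ 2 = 4 / (1 - ‖z‖) ^ 2 * d := by ring
    have h4 : 0 ≤ 3 / (1 - ‖z‖) * d := by positivity
    gcongr
    rw [hL, add_mul]
    linarith
  have hbound : ‖herglotzExponent ν w‖ ≤ M * s := by
    have := norm_herglotzExponent_le ν hw1 him
    rwa [hwz] at this
  have hfac : (∫ ζ : Circle, (1 - (ζ : ℂ)) / (1 - (ζ : ℂ) * w) ∂ν) / D * (1 + ((1 - w) * D - 1)) =
      herglotzExponent ν w := by
    rw [herglotzExponent_eq ν hw1]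
    generalize ∫ ζ : Circle, (1 - (ζ : ℂ)) / (1 - (ζ : ℂ) * w) ∂ν = N
    field_simp
    ring
  obtain ⟨E, hE, hE'⟩ := exists_exp_error hfac hv hLd hbound hdiff hs0 hs3 hM0.le hMs
  exact ⟨E, by rw [BT_eq_bT_mul τ μ hz hw hD0, hE]; rfl, hE'⟩

theorem eventually_integral_norm_sub_one_le {kn : ℕ → ℕ} {μ : ℕ → ℕ → Measure Circle}
    [∀ n i, IsProbabilityMeasure (μ n i)] (hinf : IsInfinitesimalArrayT kn μ) {ε : ℝ}
    (hε : 0 < ε) : ∀ᶠ n in atTop, ∀ i < kn n, ∫ ζ : Circle, ‖(ζ : ℂ) - 1‖ ∂(μ n i) ≤ ε := by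
  obtain ⟨N, hN⟩ := hinf (ε / 2) (by positivity) (ENNReal.ofReal (ε / 4)) (by positivity)
  filter_upwards [eventually_ge_atTop N] with n hn i hi
  set A : Set Circle := {ζ : Circle | ε / 2 ≤ ‖(ζ : ℂ) - 1‖} with hA
  have hAm : MeasurableSet A :=
    (isClosed_le (by fun_prop) (by fun_prop) : IsClosed A).measurableSet
  have h1 : (μ n i).real A ≤ ε / 4 :=
    ENNReal.toReal_le_of_le_ofReal (by positivity) (hN n hn i hi).le
  have h2 : Integrable (A.indicator fun _ => (2 : ℝ)) (μ n i) :=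
    (integrable_const _).indicator hAm
  have h3 : ∫ ζ : Circle, ‖(ζ : ℂ) - 1‖ ∂(μ n i) ≤
      ∫ ζ : Circle, (ε / 2 + A.indicator (fun _ => (2 : ℝ)) ζ) ∂(μ n i) := by
    refine integral_mono (Continuous.integrable_circle (by fun_prop) _)
      ((integrable_const _).add h2) fun ζ => ?_
    by_cases hζ : ζ ∈ A
    · have h4 := norm_sub_le (ζ : ℂ) 1
      rw [Circle.norm_coe, norm_one] at h4
      simp only [Set.indicator_of_mem hζ]
      linarith
    · simp only [Set.indicator_of_notMem hζ, add_zero]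
      exact (not_le.1 hζ).le
  rw [integral_add (integrable_const _) h2, integral_indicator_const _ hAm] at h3
  simp only [integral_const, probReal_univ, smul_eq_mul, one_mul] at h3
  linarith

instance isFiniteMeasure_sigmaNT (τ : ℝ) (kn : ℕ → ℕ) (μ : ℕ → ℕ → Measure Circle)
    [∀ n i, IsProbabilityMeasure (μ n i)] (n : ℕ) : IsFiniteMeasure (sigmaNT τ kn μ n) := by
  have (i : ℕ) : IsFiniteMeasure ((centerT τ (μ n i)).withDensity
      (fun ζ => ENNReal.ofReal (1 - ((ζ : ℂ)).re))) :=
    isFiniteMeasure_withDensity_ofReal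
      (Continuous.integrable_circle (by fun_prop : Continuous fun ζ : Circle => 1 - (ζ : ℂ).re)
        _).hasFiniteIntegral
  unfold sigmaNT
  infer_instance

theorem integral_sigmaNT {E : Type*} [NormedAddCommGroup E] [NormedSpace ℝ E] (τ : ℝ)
    (kn : ℕ → ℕ) (μ : ℕ → ℕ → Measure Circle) [∀ n i, IsProbabilityMeasure (μ n i)] (n : ℕ)
    {f : Circle → E} (hf : Continuous f) :
    ∫ ζ, f ζ ∂(sigmaNT τ kn μ n) =
      ∑ i ∈ Finset.range (kn n), ∫ ζ : Circle, (1 - (ζ : ℂ).re) • f ζ ∂(centerT τ (μ n i)) := by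
  have hc : Continuous fun ζ : Circle => 1 - (ζ : ℂ).re := by fun_prop
  have hfin (i : ℕ) : IsFiniteMeasure ((centerT τ (μ n i)).withDensity
      (fun ζ => ENNReal.ofReal (1 - ((ζ : ℂ)).re))) :=
    isFiniteMeasure_withDensity_ofReal (hc.integrable_circle _).hasFiniteIntegral
  rw [sigmaNT, integral_finsetSum_measure fun i _ => hf.integrable_circle _]
  refine Finset.sum_congr rfl fun i _ => ?_
  rw [integral_withDensity_eq_integral_toReal_smul hc.measurable.ennreal_ofReal
    (.of_forall fun _ => ENNReal.ofReal_lt_top)]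
  refine integral_congr_ae (.of_forall fun ζ => ?_)
  have h1 : 0 ≤ 1 - (ζ : ℂ).re := by
    simpa using (re_le_norm (ζ : ℂ)).trans_eq (Circle.norm_coe ζ)
  simp only [ENNReal.toReal_ofReal h1]

theorem sigmaNT_real_univ (τ : ℝ) (kn : ℕ → ℕ) (μ : ℕ → ℕ → Measure Circle)
    [∀ n i, IsProbabilityMeasure (μ n i)] (n : ℕ) :
    (sigmaNT τ kn μ n).real Set.univ =
      ∑ i ∈ Finset.range (kn n), ∫ ζ : Circle, (1 - (ζ : ℂ).re) ∂(centerT τ (μ n i)) := by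
  have h1 : (sigmaNT τ kn μ n).real Set.univ = ∫ _ : Circle, (1 : ℝ) ∂(sigmaNT τ kn μ n) := by
    simp
  rw [h1, integral_sigmaNT τ kn μ n continuous_const]
  simp

theorem sum_hT (τ : ℝ) (kn : ℕ → ℕ) (μ : ℕ → ℕ → Measure Circle)
    [∀ n i, IsProbabilityMeasure (μ n i)] (n : ℕ) {z : ℂ} (hz : ‖z‖ < 1) :
    ∑ i ∈ Finset.range (kn n), hT τ (μ n i) z =
      -I * ((∑ i ∈ Finset.range (kn n), ∫ ζ : Circle, (ζ : ℂ).im ∂(centerT τ (μ n i)) : ℝ) : ℂ) +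
        ∫ ζ : Circle, (1 + (ζ : ℂ) * z) / (1 - (ζ : ℂ) * z) ∂(sigmaNT τ kn μ n) := by
  rw [integral_sigmaNT τ kn μ n (continuous_herglotz_kernel hz), ofReal_sum, Finset.mul_sum,
    ← Finset.sum_add_distrib]
  refine Finset.sum_congr rfl fun i _ => ?_
  rw [hT]
  simp only [real_smul, mul_comm]

theorem eventually_prod_BT_eq {τ : ℝ} (hτ : 0 < τ) (hτ' : τ < Real.pi) {kn : ℕ → ℕ}
    {μ : ℕ → ℕ → Measure Circle} [∀ n i, IsProbabilityMeasure (μ n i)]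
    (hinf : IsInfinitesimalArrayT kn μ) (lam : ℕ → Circle) {z : ℂ} (hz : ‖z‖ < 1) {ε : ℝ}
    (hε : 0 < ε) : ∀ᶠ n in atTop, ∃ E : ℂ,
      (lam n : ℂ) * ∏ i ∈ Finset.range (kn n), BT (μ n i) z =
        gammaNT τ kn μ lam n *
          exp (-(∫ ζ : Circle, (1 + (ζ : ℂ) * z) / (1 - (ζ : ℂ) * z) ∂(sigmaNT τ kn μ n)) + E) ∧
      ‖E‖ ≤ ε * (sigmaNT τ kn μ n).real Set.univ := by
  obtain ⟨K, hK, δ, hδ, H⟩ := exists_BT_eq_exp hτ hτ' hz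
  filter_upwards [eventually_integral_norm_sub_one_le hinf hδ,
    eventually_integral_norm_sub_one_le hinf (show 0 < ε / K by positivity)] with n h1 h2
  have H' : ∀ i, ∃ E : ℂ, i ∈ Finset.range (kn n) →
      BT (μ n i) z = bT τ (μ n i) * exp (-hT τ (μ n i) z + E) ∧
        ‖E‖ ≤ ε * ∫ ζ : Circle, (1 - (ζ : ℂ).re) ∂(centerT τ (μ n i)) := by
    intro i
    by_cases hi : i ∈ Finset.range (kn n)
    · obtain ⟨E, hE, hE'⟩ := H (μ n i) (h1 i (Finset.mem_range.1 hi))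
      refine ⟨E, fun _ => ⟨hE, hE'.trans ?_⟩⟩
      have h3 : K * ∫ ζ : Circle, ‖(ζ : ℂ) - 1‖ ∂(μ n i) ≤ ε := by
        rw [mul_comm]
        exact (le_div_iff₀ hK).1 (h2 i (Finset.mem_range.1 hi))
      exact mul_le_mul_of_nonneg_right h3 (integral_one_sub_re_nonneg _)
    · exact ⟨0, fun h => absurd h hi⟩
  choose E hE using H'
  refine ⟨∑ i ∈ Finset.range (kn n), E i, ?_, ?_⟩
  · have hlam : (lam n : ℂ) = exp (arg (lam n : ℂ) * I) := by
      conv_lhs => rw [← Circle.exp_arg (lam n), Circle.coe_exp]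
    rw [Finset.prod_congr rfl fun i hi => (hE i hi).1]
    simp only [bT, Circle.coe_exp, ← Complex.exp_add]
    conv_lhs => rw [hlam]
    rw [← Complex.exp_sum, ← Complex.exp_add, gammaNT, ← Complex.exp_add]
    congr 1
    have hs := sum_hT τ kn μ n hz
    rw [Finset.sum_add_distrib, Finset.sum_add_distrib, Finset.sum_neg_distrib, hs]
    push_cast
    rw [← Finset.sum_mul]
    ring
  · rw [sigmaNT_real_univ, Finset.mul_sum]
    exact norm_sum_le_of_le _ fun i hi => (hE i hi).2

theorem tendsto_of_abs_sub_le_mul {a s : ℕ → ℝ} {S : ℝ} (ha : Tendsto a atTop (𝓝 S))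
    (h : ∀ ε > 0, ∀ᶠ n in atTop, |s n - a n| ≤ ε * s n) : Tendsto s atTop (𝓝 S) := by
  have hbound : ∀ᶠ n in atTop, s n ≤ 2 * (|S| + 1) := by
    filter_upwards [h (1 / 2) (by norm_num), ha.eventually_lt_const (lt_add_one S)] with n h1 h2
    linarith [le_abs_self (s n - a n), le_abs_self S]
  have hdiff : Tendsto (fun n => s n - a n) atTop (𝓝 0) := by
    rw [Metric.tendsto_nhds]
    intro η hη
    filter_upwards [hbound, h (η / (4 * (|S| + 1))) (by positivity)] with n h1 h2
    rw [Real.dist_0_eq_abs]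
    refine h2.trans_lt ?_
    have h3 : η / (4 * (|S| + 1)) * s n ≤ η / (4 * (|S| + 1)) * (2 * (|S| + 1)) := by gcongr
    have h4 : η / (4 * (|S| + 1)) * (2 * (|S| + 1)) = η / 2 := by
      field_simp
      norm_num
    linarith
  simpa using hdiff.add ha

theorem norm_gammaNT (τ : ℝ) (kn : ℕ → ℕ) (μ : ℕ → ℕ → Measure Circle) (lam : ℕ → Circle)
    (n : ℕ) : ‖gammaNT τ kn μ lam n‖ = 1 := by
  rw [gammaNT]
  exact norm_exp_I_mul_ofReal _

theorem integral_herglotz_kernel_zero (ν : Measure Circle) :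
    ∫ ζ : Circle, (1 + (ζ : ℂ) * 0) / (1 - (ζ : ℂ) * 0) ∂ν = (ν.real Set.univ : ℂ) := by
  simp

theorem norm_BID (γ : Circle) (σ : Measure Circle) (z : ℂ) :
    ‖BID γ σ z‖ =
      Real.exp (-(∫ ζ : Circle, (1 + (ζ : ℂ) * z) / (1 - (ζ : ℂ) * z) ∂σ).re) := by
  rw [BID, norm_mul, Circle.norm_coe, one_mul, norm_exp, neg_re]

theorem BID_ne_zero (γ : Circle) (σ : Measure Circle) (z : ℂ) : BID γ σ z ≠ 0 :=
  mul_ne_zero γ.coe_ne_zero (exp_ne_zero _)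

/-- Theorem 3.5, (1) ⇒ (3): if the boolean convolutions δ_{λ_n} ⨃ μ_{n1} ⨃ ⋯ ⨃ μ_{nk_n}
converge weakly to ν_⨃^{γ,σ}, then σ_n → σ weakly and γ_n → γ. -/
theorem stmt5
    (τ : ℝ) (hτ : 0 < τ ∧ τ < Real.pi)
    (γ : Circle) (σ : Measure Circle) (hσ : IsFiniteMeasure σ)
    (kn : ℕ → ℕ) (μ : ℕ → ℕ → Measure Circle)
    (hprob : ∀ n i, IsProbabilityMeasure (μ n i))
    (hinf : IsInfinitesimalArrayT kn μ)
    (hmom : ∀ n : ℕ, ∀ i < kn n, (∫ ζ : Circle, (ζ : ℂ) ∂(μ n i)) ≠ 0)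
    (lam : ℕ → Circle)
    (hconv : ∀ K : Set ℂ, K ⊆ ball (0:ℂ) 1 → IsCompact K →
      TendstoUniformlyOn
        (fun n z => ((lam n : ℂ)) * ∏ i ∈ Finset.range (kn n), BT (μ n i) z)
        (BID γ σ) atTop K) :
    (∀ f : C(Circle, ℝ),
      Tendsto (fun n => ∫ ζ, f ζ ∂(sigmaNT τ kn μ n)) atTop (𝓝 (∫ ζ, f ζ ∂σ))) ∧
    Tendsto (fun n => gammaNT τ kn μ lam n) atTop (𝓝 (γ : ℂ)) := by
  obtain ⟨hτ, hτ'⟩ := hτ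
  have hpt : ∀ z : ℂ, ‖z‖ < 1 → Tendsto
      (fun n => (lam n : ℂ) * ∏ i ∈ Finset.range (kn n), BT (μ n i) z) atTop (𝓝 (BID γ σ z)) :=
    fun z hz => (hconv {z} (by simpa using hz) isCompact_singleton).tendsto_at rfl
  have hS : Tendsto (fun n => (sigmaNT τ kn μ n).real Set.univ) atTop (𝓝 (σ.real Set.univ)) := by
    have h0 := (hpt 0 (by simp)).norm
    rw [norm_BID, integral_herglotz_kernel_zero, ofReal_re] at h0
    have h1 := ((Real.continuousAt_log (Real.exp_pos _).ne').tendsto.comp h0).neg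
    rw [Real.log_exp, neg_neg] at h1
    refine tendsto_of_abs_sub_le_mul h1 fun ε hε => ?_
    filter_upwards [eventually_prod_BT_eq hτ hτ' hinf lam (z := 0) (by simp) hε] with n hn
    obtain ⟨E, hE, hE'⟩ := hn
    rw [integral_herglotz_kernel_zero] at hE
    rw [Function.comp_apply, hE, norm_mul, norm_gammaNT, one_mul, norm_exp, Real.log_exp, add_re,
      neg_re, ofReal_re]
    refine le_trans ?_ hE'
    rw [show ∀ a b : ℝ, a - -(-a + b) = b by intros; ring]
    exact abs_re_le_norm E
  have hS0 : 0 ≤ σ.real Set.univ := measureReal_nonneg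
  have hSle : ∀ᶠ n in atTop, (sigmaNT τ kn μ n).real Set.univ ≤ σ.real Set.univ + 1 :=
    (hS.eventually_lt_const (lt_add_one _)).mono fun _ => le_of_lt
  have hG : ∀ z : ℂ, ‖z‖ < 1 → Tendsto (fun n => gammaNT τ kn μ lam n *
      exp (-∫ ζ : Circle, (1 + (ζ : ℂ) * z) / (1 - (ζ : ℂ) * z) ∂(sigmaNT τ kn μ n))) atTop
      (𝓝 (BID γ σ z)) := by
    intro z hz
    set G : ℕ → ℂ := fun n => gammaNT τ kn μ lam n *
      exp (-∫ ζ : Circle, (1 + (ζ : ℂ) * z) / (1 - (ζ : ℂ) * z) ∂(sigmaNT τ kn μ n)) with hGdef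
    set T : ℕ → ℂ := fun n => (lam n : ℂ) * ∏ i ∈ Finset.range (kn n), BT (μ n i) z with hTdef
    have hG0 : ∀ n, G n ≠ 0 := fun n => mul_ne_zero
      (norm_ne_zero_iff.1 (by rw [norm_gammaNT]; exact one_ne_zero)) (exp_ne_zero _)
    have hR : Tendsto (fun n => T n / G n) atTop (𝓝 1) := by
      rw [Metric.tendsto_nhds]
      intro η hη
      obtain ⟨δ, hδ, hexp⟩ := Metric.continuousAt_iff.1 (continuous_exp.continuousAt (x := 0)) η hη
      filter_upwards [hSle, eventually_prod_BT_eq hτ hτ' hinf lam hz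
        (show 0 < δ / (2 * (σ.real Set.univ + 1)) by positivity)] with n h1 h2
      obtain ⟨E, hE, hE'⟩ := h2
      have h3 : T n / G n = exp E := by
        rw [div_eq_iff (hG0 n), hTdef, hGdef]
        simp only
        rw [hE, Complex.exp_add]
        ring
      rw [h3, ← Complex.exp_zero]
      refine hexp ?_
      rw [dist_zero_right]
      refine hE'.trans_lt ?_
      calc δ / (2 * (σ.real Set.univ + 1)) * (sigmaNT τ kn μ n).real Set.univ
          ≤ δ / (2 * (σ.real Set.univ + 1)) * (σ.real Set.univ + 1) := by gcongr
        _ = δ / 2 := by field_simp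
        _ < δ := by linarith
    have hT0 : ∀ᶠ n in atTop, T n ≠ 0 := (hpt z hz).eventually_ne (BID_ne_zero γ σ z)
    have h4 := (hpt z hz).div hR one_ne_zero
    rw [div_one] at h4
    refine h4.congr' ?_
    filter_upwards [hT0] with n hn
    exact div_div_cancel₀ hn
  constructor
  · have hre : ∀ z : ℂ, ‖z‖ < 1 → Tendsto
        (fun n => ∫ ζ : Circle, ((1 + (ζ : ℂ) * z) / (1 - (ζ : ℂ) * z)).re ∂(sigmaNT τ kn μ n))
        atTop (𝓝 (∫ ζ : Circle, ((1 + (ζ : ℂ) * z) / (1 - (ζ : ℂ) * z)).re ∂σ)) := by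
      intro z hz
      have e : ∀ (ν : Measure Circle) [IsFiniteMeasure ν],
          ∫ ζ : Circle, ((1 + (ζ : ℂ) * z) / (1 - (ζ : ℂ) * z)).re ∂ν =
            (∫ ζ : Circle, (1 + (ζ : ℂ) * z) / (1 - (ζ : ℂ) * z) ∂ν).re := fun ν _ =>
        integral_re ((continuous_herglotz_kernel hz).integrable_circle ν)
      simp only [e]
      have h0 := (hG z hz).norm
      simp only [norm_mul, norm_gammaNT, one_mul, norm_exp, neg_re] at h0
      rw [norm_BID] at h0
      have h1 := ((Real.continuousAt_log (Real.exp_pos _).ne').tendsto.comp h0).neg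
      simpa [Function.comp_def] using h1
    exact tendsto_integral_of_tendsto_integral_pow hSle
      (tendsto_integral_pow fun m u => (tendsto_integral_re_pow_div hSle hS hre m u).2)
  · have h0 := hG 0 (by simp)
    rw [BID] at h0
    simp only [integral_herglotz_kernel_zero] at h0
    have h1 : Tendsto (fun n => exp ((sigmaNT τ kn μ n).real Set.univ : ℂ)) atTop
        (𝓝 (exp (σ.real Set.univ : ℂ))) :=
      (continuous_exp.comp continuous_ofReal).continuousAt.tendsto.comp hS
    have h2 := h0.mul h1
    simpa only [mul_assoc, ← Complex.exp_add, neg_add_cancel, Complex.exp_zero, mul_one] using h2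

end
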